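/- Let k be a positive integer, and set k' = k if k is even and k' = k + 1 if k is odd. Let G be a canonical plumbing graph that fails Property X_k and does not contain C_{k'} as an induced subgraph, and suppose G has a vertex g with |w(g)| ≥ 2k' + 6. Then the configuration obtained as the subgraph of G induced by V(G) ∖ {g} also fails Property X_k. -/

import Mathlib

namespace LensPaper

/-- A finite weighted simple graph: the combinatorial data underlying a configuration
(a disjoint union of weighted linear graphs).  The fact that every connected component
is a path is recorded separately by `Config.IsLinear`. -/
structure Config where
  V : Type
  fin : Fintype V
  deq : DecidableEq V
  graph : SimpleGraph V
  adjDec : DecidableRel graph.Adj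
  w : V → ℤ

attribute [instance] Config.fin Config.deq Config.adjDec

namespace Config

/-- The degree of a vertex. -/
noncomputable def deg (C : Config) (v : C.V) : ℕ := (C.graph.neighborSet v).ncard

/-- A configuration: every component is a path, i.e. all degrees are at most `2` and the
graph is acyclic. -/
def IsLinear (C : Config) : Prop :=
  (∀ v : C.V, C.deg v ≤ 2) ∧ C.graph.IsAcyclic

/-- The adjusted weight `w'(v) = w(v) - deg(v)`. -/
noncomputable def adjw (C : Config) (v : C.V) : ℤ := C.w v - C.deg v

/-- A vertex is bad if it is adjacent to two distinct vertices of positive adjusted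
weight. -/
def IsBad (C : Config) (x : C.V) : Prop :=
  ∃ u v : C.V, u ≠ v ∧ C.graph.Adj x u ∧ C.graph.Adj x v ∧ 0 < C.adjw u ∧ 0 < C.adjw v

/-- A leaf: a vertex of degree at most one. -/
def IsLeaf (C : Config) (v : C.V) : Prop := C.deg v ≤ 1

/-- `v 0, v 1, …, v m` is a chain of consecutive (distinct) vertices. -/
def IsChain (C : Config) (m : ℕ) (v : ℕ → C.V) : Prop :=
  (∀ i ≤ m, ∀ j ≤ m, v i = v j → i = j) ∧ ∀ i < m, C.graph.Adj (v i) (v (i + 1))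

/-- The chain `v 0, …, v m` has the list `p` as its sequence of adjusted weights. -/
def ChainPattern (C : Config) (m : ℕ) (v : ℕ → C.V) (p : List ℤ) : Prop :=
  C.IsChain m v ∧ m + 1 = p.length ∧ ∀ i : Fin p.length, C.adjw (v i) = p.get i

/-- `Γ` contains a chain of consecutive vertices whose adjusted weights, read in order,
form the list `p`. -/
def HasPattern (C : Config) (p : List ℤ) : Prop := ∃ m v, C.ChainPattern m v p

/-- A chain realizing a bad-part pattern `p` (each entry of `p` is an adjusted weight
together with a flag marking the bad positions): the chain has the prescribed adjusted
weights, and the bad vertices of the configuration are exactly the vertices of the chain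
in the flagged positions. -/
def IsBadPartChain (C : Config) (p : List (ℤ × Bool)) (m : ℕ) (v : ℕ → C.V) : Prop :=
  C.IsChain m v ∧ m + 1 = p.length ∧
  (∀ i : Fin p.length, C.adjw (v i) = (p.get i).1) ∧
  (∀ x : C.V, C.IsBad x ↔ ∃ i : Fin p.length, (p.get i).2 = true ∧ v i = x)

end Config

/-- The chains of adjusted weights forbidden by Working Condition VI. -/
def forbiddenPatterns : List (List ℤ) :=
  [[1, 0, 0, 2], [1, 0, 0, 3], [1, 0, 0, 0, 3], [1, 1, 0, 0, 1, 2], [3, 1, 0, 0, 1],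
   [1, 0, 1, 2], [1, 0, 1, 3], [1, 1, 0, 2], [1, 1, 0, 1, 1, 2]]

/-- The bad-part patterns of Working Condition VII; `true` marks the bad positions. -/
def badPatterns : List (List (ℤ × Bool)) :=
  [[(1, false), (0, true), (1, false)],
   [(1, false), (0, true), (2, false)],
   [(1, false), (0, true), (3, false)],
   [(1, false), (1, true), (1, false)],
   [(1, false), (1, true), (2, false)],
   [(1, false), (2, true), (1, false)],
   [(1, false), (0, true), (1, false), (0, true), (1, false)],
   [(1, false), (0, true), (1, false), (0, true), (2, false)],
   [(1, false), (0, true), (1, false), (1, true), (1, false)],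
   [(1, false), (0, true), (1, false), (1, true), (2, false)],
   [(1, false), (1, true), (1, true), (1, false)],
   [(1, false), (1, true), (1, true), (1, true), (1, false)],
   [(1, false), (1, true), (2, true), (1, false)]]

namespace Config

/-- The Working Conditions (I)–(VII). -/
def WorkingConditions (C : Config) : Prop :=
  (∀ v : C.V, 2 ≤ C.w v) ∧
  (∀ v : C.V, C.adjw v ≤ 3) ∧
  (∀ u v : C.V, 1 < C.adjw u → 1 < C.adjw v → u = v) ∧
  (∀ v x : C.V, 1 < C.adjw v → C.IsBad x → C.adjw x = 1 → C.graph.Adj x v) ∧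
  ((∃ v : C.V, C.adjw v = 3) →
     ∀ u u' : C.V, C.graph.Adj u u' → C.adjw u = 1 → C.adjw u' = 1 → False) ∧
  (∀ u v x : C.V, C.graph.Adj u v → C.adjw u = 1 → C.adjw v = 1 →
     C.IsBad x → C.adjw x = 2 → C.graph.Adj x u ∨ C.graph.Adj x v) ∧
  (∀ p ∈ forbiddenPatterns, ¬ C.HasPattern p) ∧
  ((∃ x : C.V, C.IsBad x) → ∃ p ∈ badPatterns, ∃ m v, C.IsBadPartChain p m v)

end Config

/-- The standard inner product on `ℤ^N`. -/
def dot {N : ℕ} (x y : Fin N → ℤ) : ℤ := ∑ i, x i * y i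

/-- The support of a vector of `ℤ^N` with respect to the standard orthonormal basis. -/
def supp {N : ℕ} (x : Fin N → ℤ) : Finset (Fin N) :=
  Finset.univ.filter fun i => x i ≠ 0

namespace Config

/-- An embedding of a configuration into `ℤ^N`. -/
def IsEmbedding (C : Config) (N : ℕ) (φ : C.V → Fin N → ℤ) : Prop :=
  ∀ u v : C.V, dot (φ u) (φ v) =
    if u = v then C.w u else if C.graph.Adj u v then -1 else 0

/-- The restriction of `φ` to `S` is standard. -/
def IsStandardOn (C : Config) (N : ℕ) (φ : C.V → Fin N → ℤ) (S : Set C.V) : Prop :=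
  ∀ u ∈ S, ∀ v ∈ S,
    ((supp (φ u) ∩ supp (φ v)).card : ℤ) =
      if u = v then C.w v else if C.graph.Adj u v then 1 else 0

/-- A standard embedding. -/
def IsStandard (C : Config) (N : ℕ) (φ : C.V → Fin N → ℤ) : Prop :=
  C.IsStandardOn N φ Set.univ

/-- The restriction of `φ` to `S` is semi-standard at `x`. -/
def IsSemiStandardAtOn (C : Config) (N : ℕ) (φ : C.V → Fin N → ℤ) (x : C.V)
    (S : Set C.V) : Prop :=
  (∀ u ∈ S, ∀ v ∈ S,
    ((supp (φ u) ∩ supp (φ v)).card : ℤ) =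
      if u = v then C.w v
      else if C.graph.Adj u v then 1
      else if C.graph.Adj x u ∧ C.graph.Adj x v then 2
      else 0) ∧
  (∀ u ∈ S, ∀ v ∈ S, u ≠ v → C.graph.Adj x u → C.graph.Adj x v →
    (supp (φ u) ∩ supp (φ x) ∩ supp (φ v)).card = 1)

/-- A semi-standard embedding: semi-standard at some bad vertex. -/
def IsSemiStandard (C : Config) (N : ℕ) (φ : C.V → Fin N → ℤ) : Prop :=
  ∃ x : C.V, C.IsBad x ∧ C.IsSemiStandardAtOn N φ x Set.univ

/-- A candidate for the extended bad part: a chain containing the bad part whose two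
ends are either leaves or preceded by two consecutive vertices of vanishing adjusted
weight. -/
def IsEBPCand (C : Config) (m : ℕ) (v : ℕ → C.V) : Prop :=
  C.IsChain m v ∧
  (∀ p ∈ badPatterns, ∀ mb vb, C.IsBadPartChain p mb vb →
     ∀ i ≤ mb, ∃ j ≤ m, v j = vb i) ∧
  (C.IsLeaf (v 0) ∨ (2 ≤ m ∧ C.adjw (v 1) = 0 ∧ C.adjw (v 2) = 0)) ∧
  (C.IsLeaf (v m) ∨ (2 ≤ m ∧ C.adjw (v (m - 1)) = 0 ∧ C.adjw (v (m - 2)) = 0))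

/-- The extended bad part: a candidate with the fewest vertices. -/
def IsExtBadPart (C : Config) (m : ℕ) (v : ℕ → C.V) : Prop :=
  C.IsEBPCand m v ∧ ∀ m' v', C.IsEBPCand m' v' → m ≤ m'

/-- The set of vertices of the chain `v 0, …, v m`. -/
def ebpSet (C : Config) (m : ℕ) (v : ℕ → C.V) : Set C.V := {y | ∃ i ≤ m, v i = y}

/-- The outside part of `Γ` relative to the extended bad part `v 0, …, v m`. -/
def OutsidePart (C : Config) (m : ℕ) (v : ℕ → C.V) : Set C.V :=
  {x | ∀ i ≤ m, v i ≠ x}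
  ∪ {x | ¬ C.IsLeaf (v 0) ∧ (x = v 0 ∨ x = v 1 ∨ x = v 2)}
  ∪ {x | ¬ C.IsLeaf (v m) ∧ (x = v m ∨ x = v (m - 1) ∨ x = v (m - 2))}

/-- A screw at the front end of the extended bad part. -/
def IsFrontScrew (C : Config) (N : ℕ) (φ : C.V → Fin N → ℤ) (m : ℕ) (v : ℕ → C.V)
    (e : Fin N) : Prop :=
  ¬ C.IsLeaf (v 0) ∧ 3 ≤ m ∧ φ (v 2) e ≠ 0 ∧ φ (v 3) e ≠ 0

/-- A screw at the back end of the extended bad part. -/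
def IsBackScrew (C : Config) (N : ℕ) (φ : C.V → Fin N → ℤ) (m : ℕ) (v : ℕ → C.V)
    (e : Fin N) : Prop :=
  ¬ C.IsLeaf (v m) ∧ 3 ≤ m ∧ φ (v (m - 2)) e ≠ 0 ∧ φ (v (m - 3)) e ≠ 0

/-- All screws of `Γ` (with respect to `φ`) are clean. -/
def AllScrewsClean (C : Config) (N : ℕ) (φ : C.V → Fin N → ℤ) (m : ℕ)
    (v : ℕ → C.V) : Prop :=
  (∀ e : Fin N, C.IsFrontScrew N φ m v e →
    ∀ u : C.V, u ≠ v 2 → u ≠ v 3 → φ u e = 0) ∧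
  (∀ e : Fin N, C.IsBackScrew N φ m v e →
    ∀ u : C.V, u ≠ v (m - 2) → u ≠ v (m - 3) → φ u e = 0)

end Config
/-- The path graph on the disjoint union of the components encoded by a list of lists:
two vertices are adjacent iff they lie in the same component in consecutive
positions. -/
def ofListGraph (L : List (List ℤ)) :
    SimpleGraph ((i : Fin L.length) × Fin (L.get i).length) where
  Adj a b := a.1 = b.1 ∧ ((a.2 : ℕ) + 1 = (b.2 : ℕ) ∨ (b.2 : ℕ) + 1 = (a.2 : ℕ))
  symm := ⟨fun a b h => ⟨h.1.symm, h.2.symm⟩⟩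
  loopless := by
    constructor
    intro a h
    rcases h with ⟨-, h | h⟩ <;> omega

instance ofListGraphDec (L : List (List ℤ)) : DecidableRel (ofListGraph L).Adj :=
  fun a b => decidable_of_iff
    (a.1 = b.1 ∧ ((a.2 : ℕ) + 1 = (b.2 : ℕ) ∨ (b.2 : ℕ) + 1 = (a.2 : ℕ))) Iff.rfl

/-- The configuration (disjoint union of weighted paths) encoded by a list of
components, each component being the list of its weights read along the path. -/
def ofList (L : List (List ℤ)) : Config where
  V := (i : Fin L.length) × Fin (L.get i).length
  fin := inferInstance
  deq := inferInstance
  graph := ofListGraph L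
  adjDec := ofListGraphDec L
  w := fun a => (L.get a.1).get a.2

/-- `A` occurs as an induced subgraph of `B`: an injective, weight-preserving map
that preserves and reflects adjacency. -/
def IsInducedSubgraph (A B : Config) : Prop :=
  ∃ f : A.V → B.V, Function.Injective f ∧
    (∀ v, B.w (f v) = A.w v) ∧
    (∀ u v, A.graph.Adj u v ↔ B.graph.Adj (f u) (f v))

/-- `A` is (isomorphic to) the subgraph of `B` induced by the vertex set `S`. -/
def IsInducedOn (A B : Config) (S : Set B.V) : Prop :=
  ∃ f : A.V → B.V, Function.Injective f ∧
    (∀ v, B.w (f v) = A.w v) ∧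
    (∀ u v, A.graph.Adj u v ↔ B.graph.Adj (f u) (f v)) ∧
    Set.range f = S

/-- Negative continued fraction `[a₁,…,aₙ]⁻ = a₁ - 1/[a₂,…,aₙ]⁻` (the empty list is
sent to `0`; with the junk value `1/0 = 0` this gives `[aₙ]⁻ = aₙ`). -/
def negCF : List ℤ → ℚ
  | [] => 0
  | a :: l => (a : ℚ) - 1 / negCF l

/-- The (positive) sequences `a` and `b` are dual: for some coprime `p > q > 0`,
`[a]⁻ = p/q` and `[b]⁻ = p/(p-q)`. -/
def DualSeqs (a b : List ℤ) : Prop :=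
  a ≠ [] ∧ b ≠ [] ∧ (∀ x ∈ a, 2 ≤ x) ∧ (∀ x ∈ b, 2 ≤ x) ∧
  ∃ p q : ℤ, 0 < q ∧ q < p ∧ Int.gcd p q = 1 ∧
    negCF a = (p : ℚ) / (q : ℚ) ∧ negCF b = (p : ℚ) / ((p : ℚ) - (q : ℚ))

/-- `P` encodes a canonical plumbing graph (weights `≤ -2`) and `D` encodes its dual:
the components correspond to each other and each pair of weight sequences is dual. -/
def IsDualPair (P D : List (List ℤ)) : Prop :=
  ∃ h : P.length = D.length,
    ∀ i : Fin P.length,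
      DualSeqs ((P.get i).map fun x => -x) (D.get (Fin.cast h i))

/-- The total number of vertices encoded by a list of components. -/
def totalLen (L : List (List ℤ)) : ℕ := (L.map List.length).sum

/-- The canonical plumbing graph encoded by `P`, with dual encoded by `D`, fails
Property `X_k`: its dual admits an embedding into `ℤ^(n-k)`, where
`n = |V(G)| + |V(Γ)|`. -/
def FailsX (k : ℕ) (P D : List (List ℤ)) : Prop :=
  k ≤ totalLen P + totalLen D ∧
  ∃ φ : (ofList D).V → Fin (totalLen P + totalLen D - k) → ℤ,
    (ofList D).IsEmbedding (totalLen P + totalLen D - k) φ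

/-- The seventeen forbidden configurations of Theorem B (iii), encoded as lists of
path components. -/
def forbidden17 : List (List (List ℤ)) :=
  [[[-5, -2]], [[-6, -2, -2]], [[-2], [-2]], [[-3], [-2, -2]], [[-3, -2, -2, -3]],
   [[-3, -5, -3, -2]], [[-2, -2, -3, -5]], [[-4, -3, -2]], [[-3, -4, -2]],
   [[-4, -4, -2, -2]], [[-3, -4, -3, -3, -2]], [[-3, -3], [-2]], [[-3, -2, -3], [-3]],
   [[-4], [-4]], [[-4], [-3, -3]], [[-4], [-3, -2, -3]], [[-3, -3], [-3, -3]]]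

namespace Config

/-- A shallow vertex of a canonical plumbing graph. -/
def IsShallow (C : Config) (v : C.V) : Prop :=
  C.w v = -2 ∨ C.w v = -4 ∨
  (C.w v = -3 ∧ ∃ u, C.graph.Adj v u ∧ C.w u = -2) ∨
  (C.w v = -3 ∧ ∃ u, C.graph.Adj v u ∧ C.w u = -3)

/-- A deep vertex of a canonical plumbing graph. -/
def IsDeep (C : Config) (v : C.V) : Prop :=
  (5 ≤ |C.w v| ∧ ∀ u, C.graph.Adj v u → ¬ C.IsShallow u) ∨
  (C.w v = -3 ∧ ∀ u, ¬ C.graph.Adj v u)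

end Config

/-- Riemenschneider duality of sequences, generated dot by dot, with the convention that
the empty sequence is dual to `[1]`. -/
inductive Riem : List ℤ → List ℤ → Prop
  | nil : Riem [] [1]
  | row {a : ℤ} {as bs : List ℤ} : 2 ≤ a → Riem (a :: as) bs → Riem ((a + 1) :: as) (2 :: bs)
  | col {b : ℤ} {as bs : List ℤ} : Riem as (b :: bs) → Riem (2 :: as) ((b + 1) :: bs)

namespace Riem

theorem ne_nil {a b : List ℤ} (h : Riem a b) : b ≠ [] := by
  cases h <;> simp

theorem nil_left {b : List ℤ} (h : Riem [] b) : b = [1] := by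
  cases h; rfl

theorem cases_cons {a₀ : ℤ} {as b : List ℤ} (h : Riem (a₀ :: as) b) :
    (3 ≤ a₀ ∧ ∃ bs, b = 2 :: bs ∧ Riem ((a₀ - 1) :: as) bs) ∨
      (a₀ = 2 ∧ ∃ b₀ bs, b = (b₀ + 1) :: bs ∧ Riem as (b₀ :: bs)) := by
  generalize ha : a₀ :: as = a at h
  cases h with
  | nil => simp at ha
  | row h2 h =>
    obtain ⟨rfl, rfl⟩ := List.cons.inj ha
    exact Or.inl ⟨by omega, _, rfl, by simpa using h⟩
  | col h =>
    obtain ⟨rfl, rfl⟩ := List.cons.inj ha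
    exact Or.inr ⟨rfl, _, _, rfl, h⟩

theorem unique {a b b' : List ℤ} (h : Riem a b) (h' : Riem a b') : b = b' := by
  induction h generalizing b' with
  | nil => exact (nil_left h').symm
  | row h2 _ ih =>
    rcases cases_cons h' with ⟨-, bs, rfl, h⟩ | ⟨h, -⟩
    · rw [ih (by simpa using h)]
    · omega
  | col _ ih =>
    rcases cases_cons h' with ⟨h, -⟩ | ⟨-, b₀, bs, rfl, h⟩
    · omega
    · obtain ⟨rfl, rfl⟩ := List.cons.inj (ih h); rfl

theorem raise {r bs : List ℤ} (h : Riem (2 :: r) bs) (m : ℕ) :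
    Riem ((2 + (m : ℤ)) :: r) (List.replicate m 2 ++ bs) := by
  induction m with
  | zero => simpa using h
  | succ m ih =>
    have := row (by omega) ih
    rw [List.replicate_succ, List.cons_append]
    convert this using 2
    push_cast; ring

theorem exists_dual {a : List ℤ} (ha : ∀ x ∈ a, 2 ≤ x) : ∃ b, Riem a b := by
  induction a with
  | nil => exact ⟨_, nil⟩
  | cons a₀ as ih =>
    obtain ⟨b, hb⟩ := ih fun x hx => ha x (List.mem_cons_of_mem _ hx)
    obtain ⟨b₀, bs, rfl⟩ := List.exists_cons_of_ne_nil hb.ne_nil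
    have h2 := ha a₀ List.mem_cons_self
    have := raise (col hb) (a₀ - 2).toNat
    rw [Int.toNat_of_nonneg (by omega), show (2 : ℤ) + (a₀ - 2) = a₀ by ring] at this
    exact ⟨_, this⟩

theorem join {l r β bl br : List ℤ} {x y A : ℤ} (hl : Riem l β) (hβ : β = bl ++ [x])
    (hr : Riem r (y :: br)) (hA : 3 ≤ A) :
    Riem (l ++ A :: r)
      (bl ++ (x + 1) :: (List.replicate (A - 3).toNat 2 ++ (y + 1) :: br)) := by
  induction hl generalizing bl x with
  | nil =>
    obtain ⟨rfl, h1⟩ := List.append_inj' (s₁ := []) (t₁ := [(1 : ℤ)]) hβ (by simp)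
    obtain rfl : 1 = x := by simpa using h1
    have := raise (col hr) ((A - 3).toNat + 1)
    rw [show (2 : ℤ) + ((A - 3).toNat + 1 : ℕ) = A by omega, List.replicate_succ] at this
    exact this
  | row h2 h ih =>
    cases bl with
    | nil => simp at hβ; exact absurd hβ.2 h.ne_nil
    | cons b bl =>
      obtain ⟨rfl, rfl⟩ := List.cons.inj hβ
      exact row h2 (ih rfl)
  | col h ih =>
    cases bl with
    | nil =>
      obtain ⟨rfl, rfl⟩ := List.cons.inj hβ
      exact col (ih (bl := []) rfl)
    | cons b bl =>
      obtain ⟨rfl, rfl⟩ := List.cons.inj hβ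
      exact col (ih (bl := _ :: bl) rfl)

theorem snoc_col {a β bs : List ℤ} {b : ℤ} (h : Riem a β) (hβ : β = bs ++ [b]) :
    Riem (a ++ [2]) (bs ++ [b + 1]) := by
  induction h generalizing bs b with
  | nil =>
    obtain ⟨rfl, h1⟩ := List.append_inj' (s₁ := []) (t₁ := [(1 : ℤ)]) hβ (by simp)
    obtain rfl : 1 = b := by simpa using h1
    exact col nil
  | row h2 h ih =>
    cases bs with
    | nil => simp at hβ; exact absurd hβ.2 h.ne_nil
    | cons b bl =>
      obtain ⟨rfl, rfl⟩ := List.cons.inj hβ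
      exact row h2 (ih rfl)
  | col h ih =>
    cases bs with
    | nil =>
      obtain ⟨rfl, rfl⟩ := List.cons.inj hβ
      exact col (ih (bs := []) rfl)
    | cons b bl =>
      obtain ⟨rfl, rfl⟩ := List.cons.inj hβ
      exact col (ih (bs := _ :: bl) rfl)

theorem snoc_row {α as b : List ℤ} {a : ℤ} (h : Riem α b) (hα : α = as ++ [a]) :
    Riem (as ++ [a + 1]) (b ++ [2]) := by
  induction h generalizing as a with
  | nil => simp at hα
  | row h2 h ih =>
    cases as with
    | nil =>
      obtain ⟨rfl, rfl⟩ := List.cons.inj hα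
      exact row (by omega) (ih (as := []) rfl)
    | cons a' as =>
      obtain ⟨rfl, rfl⟩ := List.cons.inj hα
      exact row h2 (ih (as := _ :: as) rfl)
  | col h ih =>
    cases as with
    | nil =>
      obtain ⟨rfl, rfl⟩ := List.cons.inj hα
      obtain ⟨rfl, rfl⟩ := List.cons.inj (nil_left h)
      exact row le_rfl (col nil)
    | cons a' as =>
      obtain ⟨rfl, rfl⟩ := List.cons.inj hα
      exact col (ih rfl)

theorem reverse {a b : List ℤ} (h : Riem a b) : Riem a.reverse b.reverse := by
  induction h with
  | nil => exact nil
  | row _ _ ih =>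
    rw [List.reverse_cons, List.reverse_cons]
    exact snoc_row ih List.reverse_cons
  | col _ ih =>
    rw [List.reverse_cons, List.reverse_cons]
    exact snoc_col ih List.reverse_cons

theorem runs_of_two {a β : List ℤ} (h : Riem a β) {b : ℤ} {bs : List ℤ} (hβ : β = b :: bs) :
    (∃ v, a = List.replicate (b - 2).toNat 2 ++ v) ∧
      ∀ x ∈ bs, ∃ c u v, a = c :: u ++ List.replicate (x - 3).toNat 2 ++ v := by
  induction h generalizing b bs with
  | nil =>
    obtain ⟨rfl, rfl⟩ := List.cons.inj hβ
    exact ⟨⟨[], rfl⟩, by simp⟩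
  | @row a as bs' h2 h ih =>
    obtain ⟨rfl, rfl⟩ := List.cons.inj hβ
    refine ⟨⟨_, rfl⟩, ?_⟩
    obtain ⟨b₁, bs₁, rfl⟩ := List.exists_cons_of_ne_nil h.ne_nil
    obtain ⟨⟨v, hv⟩, ih⟩ := ih rfl
    intro x hx
    rcases List.mem_cons.1 hx with rfl | hx
    · rcases le_or_gt x 2 with hx | hx
      · exact ⟨a + 1, [], as, by simp [show (x - 3).toNat = 0 by omega]⟩
      · rw [show (x - 2).toNat = (x - 3).toNat + 1 by omega, List.replicate_succ] at hv
        obtain ⟨-, rfl⟩ := List.cons.inj hv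
        exact ⟨a + 1, [], v, rfl⟩
    · obtain ⟨c, u, w, hw⟩ := ih x hx
      obtain ⟨-, rfl⟩ := List.cons.inj hw
      exact ⟨a + 1, u, w, rfl⟩
  | @col b' as bs' h ih =>
    obtain ⟨rfl, rfl⟩ := List.cons.inj hβ
    obtain ⟨⟨v, hv⟩, ih⟩ := ih rfl
    refine ⟨?_, fun x hx => ?_⟩
    · rcases le_or_gt b' 1 with hb | hb
      · exact ⟨2 :: as, by simp [show (b' + 1 - 2).toNat = 0 by omega]⟩
      · refine ⟨v, ?_⟩
        rw [show (b' + 1 - 2).toNat = (b' - 2).toNat + 1 by omega, List.replicate_succ, hv]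
        rfl
    · obtain ⟨c, u, w, hw⟩ := ih x hx
      exact ⟨2, c :: u, w, by rw [hw]; rfl⟩

theorem exists_run_of_two {a b : List ℤ} (h : Riem a b) {x : ℤ} (hx : x ∈ b) :
    ∃ u v, a = u ++ List.replicate (x - 3).toNat 2 ++ v := by
  obtain ⟨b₀, bs, rfl⟩ := List.exists_cons_of_ne_nil h.ne_nil
  obtain ⟨⟨v, hv⟩, ht⟩ := h.runs_of_two rfl
  rcases List.mem_cons.1 hx with rfl | hx
  · rcases le_or_gt x 2 with hx | hx
    · exact ⟨[], a, by simp [show (x - 3).toNat = 0 by omega]⟩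
    · rw [show (x - 2).toNat = 1 + (x - 3).toNat by omega, List.replicate_add] at hv
      exact ⟨_, v, hv⟩
  · obtain ⟨c, u, v, hv⟩ := ht x hx
    exact ⟨_, _, hv⟩

end Riem

theorem negCF_bounds {a : ℤ} {l : List ℤ} (h : ∀ x ∈ a :: l, 2 ≤ x) :
    (a : ℚ) - 1 < negCF (a :: l) ∧ negCF (a :: l) ≤ a ∧
      (l ≠ [] → negCF (a :: l) < a ∧ 1 < negCF l) := by
  induction l generalizing a with
  | nil => simp [negCF]
  | cons b l ih =>
    obtain ⟨h1, -, -⟩ := ih fun x hx => h x (List.mem_cons_of_mem _ hx)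
    have hb : (2 : ℚ) ≤ b := by exact_mod_cast h b (by simp)
    have h2 : 1 < negCF (b :: l) := by linarith
    have h3 : 0 < 1 / negCF (b :: l) := by positivity
    have h4 : 1 / negCF (b :: l) < 1 := by rw [div_lt_one (by linarith)]; exact h2
    rw [negCF]
    exact ⟨by linarith, by linarith, fun _ => ⟨by linarith, h2⟩⟩

theorem Riem.of_negCF (n : ℕ) : ∀ {a b : List ℤ}, a.length + b.length ≤ n → a ≠ [] → b ≠ [] →
    (∀ x ∈ a, 2 ≤ x) → (∀ x ∈ b, 2 ≤ x) → (negCF a - 1) * (negCF b - 1) = 1 → Riem a b := by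
  induction n with
  | zero =>
    intro a b h ha
    exact absurd (List.length_eq_zero_iff.1 (by omega)) ha
  | succ n ih =>
    intro a b hlen ha hb ha2 hb2 hab
    obtain ⟨a₀, as, rfl⟩ := List.exists_cons_of_ne_nil ha
    obtain ⟨b₀, bs, rfl⟩ := List.exists_cons_of_ne_nil hb
    obtain ⟨hx1, hx2, hx3⟩ := negCF_bounds ha2
    obtain ⟨hy1, hy2, hy3⟩ := negCF_bounds hb2
    have ha0 : 2 ≤ a₀ := ha2 a₀ (by simp)
    have hb0 : 2 ≤ b₀ := hb2 b₀ (by simp)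
    have ha0' : (2 : ℚ) ≤ a₀ := by exact_mod_cast ha0
    have hb0' : (2 : ℚ) ≤ b₀ := by exact_mod_cast hb0
    simp only [List.length_cons] at hlen
    rcases ha0.lt_or_eq with ha3 | rfl
    · have ha3' : (3 : ℚ) ≤ a₀ := by exact_mod_cast ha3
      have hy : negCF (b₀ :: bs) < 2 := by nlinarith
      have hb3 : b₀ < 3 := by
        have : (b₀ : ℚ) < 3 := by linarith
        exact_mod_cast this
      obtain rfl : b₀ = 2 := by omega
      have hbs : bs ≠ [] := by
        rintro rfl
        norm_num [negCF] at hy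
      obtain ⟨-, hz⟩ := hy3 hbs
      have := ih (a := (a₀ - 1) :: as) (b := bs) (by simp; omega) (by simp) hbs
        (by
          simp only [List.mem_cons, forall_eq_or_imp] at ha2 ⊢
          exact ⟨by omega, ha2.2⟩)
        (fun x hx => hb2 x (List.mem_cons_of_mem _ hx))
        (by
          simp only [negCF] at hab ⊢
          generalize 1 / negCF as = s at hab ⊢
          have hz0 : negCF bs ≠ 0 := by linarith
          field_simp at hab
          push_cast at hab ⊢
          linarith)
      simpa using Riem.row (by omega) this
    · rcases hb0.lt_or_eq with hb3 | rfl
      · have hb3' : (3 : ℚ) ≤ b₀ := by exact_mod_cast hb3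
        have hx : negCF (2 :: as) < 2 := by nlinarith
        have has : as ≠ [] := by
          rintro rfl
          norm_num [negCF] at hx
        obtain ⟨-, hz⟩ := hx3 has
        have := ih (a := as) (b := (b₀ - 1) :: bs) (by simp; omega) has (by simp)
          (fun x hx => ha2 x (List.mem_cons_of_mem _ hx))
          (by
            simp only [List.mem_cons, forall_eq_or_imp] at hb2 ⊢
            exact ⟨by omega, hb2.2⟩)
          (by
            simp only [negCF] at hab ⊢
            generalize 1 / negCF bs = s at hab ⊢
            have hz0 : negCF as ≠ 0 := by linarith
            field_simp at hab
            push_cast at hab ⊢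
            linarith)
        simpa using Riem.col this
      · have has : as = [] := by
          by_contra h
          have := (hx3 h).1
          push_cast at *
          nlinarith
        have hbs : bs = [] := by
          by_contra h
          have := (hy3 h).1
          push_cast at *
          nlinarith
        subst has hbs
        exact Riem.col Riem.nil

theorem DualSeqs.riem {a b : List ℤ} (h : DualSeqs a b) : Riem a b := by
  obtain ⟨ha, hb, ha2, hb2, p, q, hq, hpq, -, hx, hy⟩ := h
  refine Riem.of_negCF _ le_rfl ha hb ha2 hb2 ?_
  have hq' : (0 : ℚ) < q := by exact_mod_cast hq
  have hpq' : (q : ℚ) < p := by exact_mod_cast hpq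
  have h1 : (p : ℚ) - q ≠ 0 := by linarith
  rw [hx, hy]
  field_simp
  ring

theorem dot_comm {N : ℕ} (x y : Fin N → ℤ) : dot x y = dot y x := dotProduct_comm x y

theorem dot_sub_left {N : ℕ} (x y z : Fin N → ℤ) : dot (x - y) z = dot x z - dot y z :=
  sub_dotProduct x y z

theorem dot_sub_right {N : ℕ} (x y z : Fin N → ℤ) : dot z (x - y) = dot z x - dot z y :=
  dotProduct_sub z x y

theorem dot_smul_left {N : ℕ} (c : ℤ) (x y : Fin N → ℤ) : dot (c • x) y = c * dot x y :=
  smul_dotProduct c x y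

theorem dot_smul_right {N : ℕ} (c : ℤ) (x y : Fin N → ℤ) : dot x (c • y) = c * dot x y :=
  dotProduct_smul c x y

theorem dot_self_nonneg {N : ℕ} (x : Fin N → ℤ) : 0 ≤ dot x x :=
  Finset.sum_nonneg fun i _ => mul_self_nonneg (x i)

theorem eq_zero_of_dot_self {N : ℕ} {x : Fin N → ℤ} (h : dot x x = 0) : x = 0 :=
  dotProduct_self_eq_zero.1 h

theorem sq_le_dot_self {N : ℕ} (x : Fin N → ℤ) (i : Fin N) : x i * x i ≤ dot x x :=
  Finset.single_le_sum (f := fun i => x i * x i) (fun i _ => mul_self_nonneg (x i))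
    (Finset.mem_univ i)

theorem exists_sq_eq_one {N : ℕ} {x : Fin N → ℤ} (h0 : 0 < dot x x) (h : dot x x < 4) :
    ∃ i, x i * x i = 1 := by
  have : ∃ i, x i ≠ 0 := by
    by_contra! hx
    simp [dot, hx] at h0
  obtain ⟨i, hi⟩ := this
  refine ⟨i, ?_⟩
  have h1 := sq_le_dot_self x i
  have h2 : x i < 2 := by nlinarith
  have h3 : -2 < x i := by nlinarith
  have : x i = 1 ∨ x i = -1 := by omega
  rcases this with h | h <;> simp [h]

theorem dot_single {N : ℕ} (x : Fin N → ℤ) (i : Fin N) (c : ℤ) :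
    dot x (Pi.single i c) = x i * c := dotProduct_single x c i

/-- A vector of square two is a sum of two orthogonal unit vectors. -/
theorem exists_unit_of_dot_self_eq_two {N : ℕ} {x : Fin N → ℤ} (h : dot x x = 2) :
    ∃ a : Fin N → ℤ, dot a a = 1 ∧ dot a x = 1 := by
  obtain ⟨i, hi⟩ := exists_sq_eq_one (by omega) (by omega : dot x x < 4)
  refine ⟨Pi.single i (x i), ?_, ?_⟩
  · rw [dot_single]; simpa using hi
  · rw [dot_comm, dot_single, hi]

theorem exists_single_of_dot_self_eq_one {N : ℕ} {x : Fin N → ℤ} (h : dot x x = 1) :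
    ∃ i s, s * s = 1 ∧ x = Pi.single i s := by
  obtain ⟨i, hi⟩ := exists_sq_eq_one (by omega) (by omega : dot x x < 4)
  refine ⟨i, x i, hi, sub_eq_zero.1 (eq_zero_of_dot_self ?_)⟩
  rw [dot_sub_left, dot_sub_right, dot_sub_right, h, dot_comm _ x, dot_single, dot_single, hi]
  simp [hi]

theorem sq_dot_le {N : ℕ} {a x : Fin N → ℤ} (ha : dot a a = 1) :
    dot a x * dot a x ≤ dot x x := by
  have := dot_self_nonneg (x - dot a x • a)
  simp only [dot_sub_left, dot_sub_right, dot_smul_left, dot_smul_right, ha,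
    dot_comm x a] at this
  linarith

/-- The Gram matrix of a chain of `t` vectors of square two. -/
def IsTwoChain {N : ℕ} (t : ℕ) (v : ℕ → Fin N → ℤ) : Prop :=
  ∀ i < t, ∀ j < t, dot (v i) (v j) =
    if i = j then 2 else if i + 1 = j ∨ j + 1 = i then -1 else 0

theorem IsTwoChain.exists_start {N t : ℕ} {v : ℕ → Fin N → ℤ} (h : IsTwoChain t v)
    (ht : 4 ≤ t) :
    ∃ a : Fin N → ℤ, dot a a = 1 ∧ ∀ j < t, dot a (v j) = if j = 0 then 1 else 0 := by
  have key : ∀ a : Fin N → ℤ, dot a a = 1 → dot a (v 0) = 1 → dot a (v 1) = 0 →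
      ∀ j < t, dot a (v j) = if j = 0 then 1 else 0 := by
    intro a ha ha0 ha1 j hj
    have h00 : dot (v 0) (v 0) = 2 := by simpa using h 0 (by omega) 0 (by omega)
    have h01 : dot (v 0) (v 1) = -1 := by simpa using h 0 (by omega) 1 (by omega)
    rcases Nat.lt_or_ge j 2 with h2 | h2
    · interval_cases j <;> simpa
    rw [if_neg (by omega)]
    by_contra hc
    have h0j : dot (v 0) (v j) = 0 := by
      rw [h 0 (by omega) j hj, if_neg (by omega), if_neg (by omega)]
    have hjj : dot (v j) (v j) = 2 := by simpa using h j hj j hj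
    obtain ⟨c, hcdef⟩ : ∃ c, dot a (v j) = c := ⟨_, rfl⟩
    have hsq := sq_dot_le (x := v j) ha
    rw [hjj, hcdef] at hsq
    rw [hcdef] at hc
    have hc1 : c * c = 1 := by
      have h2 : c < 2 := by nlinarith
      have h3 : -2 < c := by nlinarith
      have : c = 1 ∨ c = -1 := by omega
      rcases this with h | h <;> simp [h]
    have hv : v j = c • (a - (v 0 - a)) := by
      refine sub_eq_zero.1 (eq_zero_of_dot_self ?_)
      simp only [dot_sub_left, dot_sub_right, dot_smul_left, dot_smul_right, ha, ha0,
        dot_comm _ a, dot_comm _ (v 0), h00, h0j, hjj, hcdef]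
      linear_combination -2 * hc1
    rcases Nat.lt_or_ge j 3 with h3 | h3
    · obtain rfl : j = 2 := by omega
      have h23 : dot (v 2) (v 3) = -1 := by simpa using h 2 (by omega) 3 (by omega)
      have h03 : dot (v 0) (v 3) = 0 := by simpa using h 0 (by omega) 3 (by omega)
      rw [hv] at h23
      simp only [dot_sub_left, dot_smul_left, h03] at h23
      generalize dot a (v 3) = d at h23
      have : 2 * (c * d) = -1 := by linarith
      omega
    · have h1j : dot (v 1) (v j) = 0 := by
        rw [h 1 (by omega) j hj, if_neg (by omega), if_neg (by omega)]
      rw [hv, dot_comm] at h1j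
      simp only [dot_sub_left, dot_smul_left, ha1, h01] at h1j
      omega
  have h00 : dot (v 0) (v 0) = 2 := by simpa using h 0 (by omega) 0 (by omega)
  have h01 : dot (v 0) (v 1) = -1 := by simpa using h 0 (by omega) 1 (by omega)
  have h11 : dot (v 1) (v 1) = 2 := by simpa using h 1 (by omega) 1 (by omega)
  obtain ⟨a, ha, ha0⟩ := exists_unit_of_dot_self_eq_two h00
  have hb : dot (v 0 - a) (v 0 - a) = 1 := by
    simp [dot_sub_left, dot_sub_right, ha, ha0, h00, dot_comm (v 0) a]
  have hb0 : dot (v 0 - a) (v 0) = 1 := by simp [dot_sub_left, ha0, h00]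
  have hb1 : dot (v 0 - a) (v 1) = -1 - dot a (v 1) := by simp [dot_sub_left, h01]
  have hs1 := sq_dot_le (x := v 1) ha
  have hs2 := sq_dot_le (x := v 1) hb
  rw [hb1, h11] at hs2
  rw [h11] at hs1
  have : dot a (v 1) = 0 ∨ dot a (v 1) = -1 := by
    generalize dot a (v 1) = d at *
    have h1 : d < 2 := by nlinarith
    have h2 : -2 < d := by nlinarith
    have h3 : d ≠ 1 := by rintro rfl; norm_num at hs2
    omega
  rcases this with h1 | h1
  · exact ⟨a, ha, key a ha ha0 h1⟩
  · exact ⟨v 0 - a, hb, key _ hb hb0 (by rw [hb1, h1]; rfl)⟩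

/-- A chain of at least four vectors of square two is `e₀ - e₁, e₁ - e₂, …` for some
orthonormal family `e`. -/
theorem IsTwoChain.exists_orthonormal {N t : ℕ} {v : ℕ → Fin N → ℤ} (h : IsTwoChain t v)
    (ht : 4 ≤ t) :
    ∃ e : ℕ → Fin N → ℤ, (∀ i ≤ t, ∀ j ≤ t, dot (e i) (e j) = if i = j then 1 else 0) ∧
      ∀ i, e (i + 1) = e i - v i := by
  obtain ⟨a, ha, hav⟩ := h.exists_start ht
  let e : ℕ → Fin N → ℤ := fun i => Nat.rec a (fun i x => x - v i) i
  have he : ∀ i, e (i + 1) = e i - v i := fun i => rfl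
  have hev : ∀ i ≤ t, ∀ j < t,
      dot (e i) (v j) = (if i = j then 1 else 0) - if i = j + 1 then 1 else 0 := by
    intro i
    induction i with
    | zero =>
      intro _ j hj
      rw [show e 0 = a from rfl, hav j hj]
      simp [eq_comm]
    | succ i ih =>
      intro hi j hj
      rw [he, dot_sub_left, ih (by omega) j hj, h i (by omega) j hj]
      split_ifs <;> omega
  have hee : ∀ j ≤ t, ∀ i ≤ j, dot (e i) (e j) = if i = j then 1 else 0 := by
    intro j
    induction j with
    | zero =>
      intro _ i hi
      obtain rfl : i = 0 := by omega
      rw [if_pos rfl]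
      exact ha
    | succ j ih =>
      intro hj i hi
      rcases hi.lt_or_eq with hi | rfl
      · rw [he, dot_sub_right, ih (by omega) i (by omega), hev i (by omega) j (by omega)]
        split_ifs <;> omega
      · rw [he, dot_sub_left, dot_sub_right, dot_sub_right, ih (by omega) j le_rfl,
          dot_comm (v j), hev j (by omega) j (by omega), h j (by omega) j (by omega)]
        simp
  refine ⟨e, fun i hi j hj => ?_, he⟩
  rcases le_total i j with hij | hij
  · exact hee j hj i hij
  · rw [dot_comm, hee i hi j hij]
    simp [eq_comm]

/-- Orthogonal projection away from an orthonormal family of integral vectors. -/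
theorem exists_projection {N m : ℕ} {e : ℕ → Fin N → ℤ}
    (he : ∀ i < m, ∀ j < m, dot (e i) (e j) = if i = j then 1 else 0) :
    m ≤ N ∧ ∃ π : (Fin N → ℤ) → Fin (N - m) → ℤ, ∀ x y, dot (π x) (π y) =
      dot x y - ∑ i ∈ Finset.range m, dot x (e i) * dot y (e i) := by
  classical
  have hsingle : ∀ i : Fin m, ∃ p s, s * s = 1 ∧ e i = Pi.single p s := fun i =>
    exists_single_of_dot_self_eq_one (by simpa using he i i.2 i i.2)
  choose p s hs hp using hsingle
  have hinj : Function.Injective p := by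
    intro i j hij
    by_contra hne
    have := he i i.2 j j.2
    rw [if_neg (fun h => hne (Fin.ext h)), hp, hp, hij, dot_single] at this
    simp only [Pi.single_eq_same] at this
    have h1 := hs i
    have h2 := hs j
    rcases mul_eq_zero.1 this with h | h <;> simp [h] at h1 h2
  have hcard : (Finset.univ.image p).card = m := by
    rw [Finset.card_image_of_injective _ hinj, Finset.card_fin]
  have hc : (Finset.univ.image p)ᶜ.card = N - m := by
    rw [Finset.card_compl, hcard, Fintype.card_fin]
  refine ⟨?_, fun x i => x ((Finset.univ.image p)ᶜ.orderEmbOfFin hc i), fun x y => ?_⟩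
  · simpa [hcard] using Finset.card_le_univ (Finset.univ.image p)
  · have h1 : ∑ i ∈ Finset.range m, dot x (e i) * dot y (e i) =
        ∑ i ∈ Finset.univ.image p, x i * y i := by
      rw [Finset.sum_image fun i _ j _ h => hinj h, Finset.sum_range]
      refine Finset.sum_congr rfl fun i _ => ?_
      rw [hp, dot_single, dot_single]
      linear_combination (x (p i) * y (p i)) * hs i
    have h2 : ∑ i : Fin (N - m), x ((Finset.univ.image p)ᶜ.orderEmbOfFin hc i) *
        y ((Finset.univ.image p)ᶜ.orderEmbOfFin hc i) =
        ∑ i ∈ (Finset.univ.image p)ᶜ, x i * y i := by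
      rw [← Finset.sum_image (f := fun i => x i * y i)
        fun i _ j _ h => (Finset.orderEmbOfFin _ hc).injective h,
        Finset.image_orderEmbOfFin_univ]
    rw [h1, dot, h2, dot, ← Finset.sum_add_sum_compl (Finset.univ.image p)]
    ring

/-- The coefficients, along the orthonormal family of a long chain of vectors of square two,
of a short vector that meets the chain at most once, and only at an end. -/
theorem coeff_eq {N t : ℕ} {v e : ℕ → Fin N → ℤ} {u : Fin N → ℤ} {l r : Prop}
    [Decidable l] [Decidable r] (ht : 1 ≤ t)
    (he : ∀ i < t + 1, ∀ j < t + 1, dot (e i) (e j) = if i = j then 1 else 0)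
    (hev : ∀ i, e (i + 1) = e i - v i) (hlr : ¬ (l ∧ r))
    (hl : ∀ i < t, dot u (v i) = (if i = 0 ∧ l then -1 else 0) + if i + 1 = t ∧ r then -1 else 0)
    (hu : dot u u < t) :
    ∀ i ≤ t, dot u (e i) = (if i = t ∧ r then 1 else 0) - if i = 0 ∧ l then 1 else 0 := by
  have hbessel : ∑ i ∈ Finset.range (t + 1), dot u (e i) * dot u (e i) ≤ dot u u := by
    obtain ⟨-, π, hπ⟩ := exists_projection he
    have := hπ u u
    have := dot_self_nonneg (π u)
    omega
  have hstep : ∀ i < t, dot u (e (i + 1)) = dot u (e i) - dot u (v i) := fun i _ => by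
    rw [hev, dot_sub_right]
  obtain ⟨c, hc⟩ : ∃ c, dot u (e 0) = c := ⟨_, rfl⟩
  have hcoef : ∀ i ≤ t, dot u (e i) =
      c + (if 0 < i ∧ l then 1 else 0) + if i = t ∧ r then 1 else 0 := by
    intro i
    induction i with
    | zero => intro _; rw [hc, if_neg (by omega), if_neg (by omega)]; ring
    | succ i ih =>
      intro hi
      rw [hstep i (by omega), ih (by omega), hl i (by omega)]
      by_cases l <;> by_cases r <;> simp_all <;> split_ifs <;> omega
  have hzero : ∀ d : ℤ, (t : ℤ) * (d * d) ≤ dot u u → d = 0 := by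
    intro d hd
    by_contra hne
    have : 1 ≤ d * d := by
      have := mul_self_pos.2 hne
      omega
    nlinarith
  by_cases h : l
  · have h0 : c + 1 = 0 := by
      apply hzero
      rw [Finset.sum_range_succ'] at hbessel
      have hr : ¬ r := fun hr => hlr ⟨h, hr⟩
      have : ∑ i ∈ Finset.range t, dot u (e (i + 1)) * dot u (e (i + 1)) =
          t * ((c + 1) * (c + 1)) := by
        rw [Finset.sum_congr rfl (g := fun _ => (c + 1) * (c + 1))]
        · simp
        · intro i hi
          rw [hcoef _ (by simp at hi; omega)]
          simp [h, hr]
      have := mul_self_nonneg (dot u (e 0))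
      omega
    intro i hi
    rw [hcoef i hi]
    simp only [h, and_true]
    split_ifs <;> omega
  · have h0 : c = 0 := by
      apply hzero
      rw [Finset.sum_range_succ] at hbessel
      have : ∑ i ∈ Finset.range t, dot u (e i) * dot u (e i) = t * (c * c) := by
        rw [Finset.sum_congr rfl (g := fun _ => c * c)]
        · simp
        · intro i hi
          have : i < t := by simpa using hi
          rw [hcoef _ this.le]
          simp [h, this.ne]
      have := mul_self_nonneg (dot u (e t))
      omega
    intro i hi
    rw [hcoef i hi]
    simp [h, h0]

/-- The `i`-th component of a list of components, empty when out of range. -/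
def row (L : List (List ℤ)) (i : ℕ) : List ℤ := L.getD i []

/-- Adjacency of positions `(component, index)` in a disjoint union of paths. -/
abbrev PosAdj (p q : ℕ × ℕ) : Prop := p.1 = q.1 ∧ (p.2 + 1 = q.2 ∨ q.2 + 1 = p.2)

/-- The position `p` is occupied in the family of paths `F`. -/
abbrev Occ (F : ℕ → List ℤ) (p : ℕ × ℕ) : Prop := p.2 < (F p.1).length

/-- The weight at a position of a family of paths. -/
def weight (F : ℕ → List ℤ) (p : ℕ × ℕ) : ℤ := (F p.1).getD p.2 0

/-- The position of a vertex. -/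
def pos {L : List (List ℤ)} (v : (ofList L).V) : ℕ × ℕ := (v.1, v.2)

theorem row_of_lt {L : List (List ℤ)} {i : ℕ} (h : i < L.length) : row L i = L[i] :=
  List.getD_eq_getElem _ _ h

theorem lt_of_occ {L : List (List ℤ)} {p : ℕ × ℕ} (h : Occ (row L) p) : p.1 < L.length := by
  by_contra hp
  rw [Occ, row, List.getD_eq_default _ _ (by omega)] at h
  simp at h

theorem occ_pos {L : List (List ℤ)} (v : (ofList L).V) : Occ (row L) (pos v) := by
  have := v.2.2
  rw [Occ, pos, row_of_lt v.1.2]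
  exact this

theorem pos_injective {L : List (List ℤ)} : Function.Injective (pos (L := L)) := by
  rintro ⟨i, j⟩ ⟨i', j'⟩ h
  obtain ⟨h1, h2⟩ := Prod.ext_iff.1 h
  obtain rfl : i = i' := Fin.ext h1
  obtain rfl : j = j' := Fin.ext h2
  rfl

theorem exists_pos {L : List (List ℤ)} {p : ℕ × ℕ} (h : Occ (row L) p) :
    ∃ v : (ofList L).V, pos v = p := by
  have h1 := lt_of_occ h
  rw [Occ, row_of_lt h1] at h
  exact ⟨⟨⟨p.1, h1⟩, ⟨p.2, h⟩⟩, rfl⟩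

theorem adj_iff_posAdj {L : List (List ℤ)} (u v : (ofList L).V) :
    (ofList L).graph.Adj u v ↔ PosAdj (pos u) (pos v) := by
  change (u.1 = v.1 ∧ _) ↔ _
  rw [Fin.ext_iff]
  rfl

theorem w_eq_weight {L : List (List ℤ)} (v : (ofList L).V) :
    (ofList L).w v = weight (row L) (pos v) := by
  have h := occ_pos v
  rw [weight, List.getD_eq_getElem _ _ h]
  simp only [pos, row_of_lt v.1.2]
  rfl

theorem totalLen_eq_card (L : List (List ℤ)) :
    totalLen L = (Finset.univ.image (pos (L := L))).card := by
  rw [Finset.card_image_of_injective _ pos_injective, Finset.card_univ]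
  have h : Fintype.card (ofList L).V = ∑ i : Fin L.length, (L.get i).length := by
    change Fintype.card ((i : Fin L.length) × Fin (L.get i).length) = _
    simp
  rw [totalLen]
  convert h.symm using 1
  · rw [← Fin.sum_univ_fun_getElem]
    rfl

theorem totalLen_le {L L' : List (List ℤ)} {S : Finset (ℕ × ℕ)} {h : ℕ × ℕ → ℕ × ℕ}
    (H : ∀ q, Occ (row L) q → q ∈ S ∨ ∃ p, Occ (row L') p ∧ h p = q) :
    totalLen L ≤ S.card + totalLen L' := by
  rw [totalLen_eq_card, totalLen_eq_card L']
  refine (Finset.card_le_card (t := S ∪ (Finset.univ.image pos).image h) ?_).trans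
    ((Finset.card_union_le _ _).trans (Nat.add_le_add_left Finset.card_image_le _))
  intro q hq
  obtain ⟨v, -, rfl⟩ := Finset.mem_image.1 hq
  rcases H _ (occ_pos v) with h | ⟨p, hp, h⟩
  · exact Finset.mem_union_left _ h
  · obtain ⟨u, rfl⟩ := exists_pos hp
    rw [← h]
    exact Finset.mem_union_right _
      (Finset.mem_image_of_mem _ (Finset.mem_image_of_mem _ (Finset.mem_univ u)))

/-- `Φ` embeds the family of paths `F` into `ℤ^N`. -/
def IsRep {N : ℕ} (F : ℕ → List ℤ) (Φ : ℕ × ℕ → Fin N → ℤ) : Prop :=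
  ∀ p q, Occ F p → Occ F q →
    dot (Φ p) (Φ q) = if p = q then weight F p else if PosAdj p q then -1 else 0

theorem exists_isRep {L : List (List ℤ)} {N : ℕ} {φ : (ofList L).V → Fin N → ℤ}
    (h : (ofList L).IsEmbedding N φ) : ∃ Φ : ℕ × ℕ → Fin N → ℤ, IsRep (row L) Φ := by
  refine ⟨Function.extend pos φ 0, fun p q hp hq => ?_⟩
  obtain ⟨u, rfl⟩ := exists_pos hp
  obtain ⟨v, rfl⟩ := exists_pos hq
  rw [pos_injective.extend_apply, pos_injective.extend_apply, h]
  simp only [pos_injective.eq_iff, w_eq_weight, adj_iff_posAdj]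

theorem IsRep.isEmbedding {L : List (List ℤ)} {N : ℕ} {Φ : ℕ × ℕ → Fin N → ℤ}
    (h : IsRep (row L) Φ) : (ofList L).IsEmbedding N (fun v => Φ (pos v)) := by
  intro u v
  rw [h _ _ (occ_pos u) (occ_pos v)]
  simp only [pos_injective.eq_iff, w_eq_weight, adj_iff_posAdj]

theorem IsRep.pad {N M : ℕ} {F : ℕ → List ℤ} {Φ : ℕ × ℕ → Fin N → ℤ} (hΦ : IsRep F Φ)
    (h : N ≤ M) : ∃ Ψ : ℕ × ℕ → Fin M → ℤ, IsRep F Ψ := by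
  obtain ⟨d, rfl⟩ := Nat.exists_eq_add_of_le h
  refine ⟨fun p => Fin.append (Φ p) 0, fun p q hp hq => ?_⟩
  rw [← hΦ p q hp hq, dot, dot, Fin.sum_univ_add]
  simp

/-- An injective walk in a disjoint union of paths is monotone. -/
theorem walk_monotone {m : ℕ} (hm : 0 < m) {p : ℕ → ℕ × ℕ}
    (hadj : ∀ j, j + 1 < m → PosAdj (p j) (p (j + 1)))
    (hinj : ∀ i < m, ∀ j < m, p i = p j → i = j) :
    ∃ e s, (∀ j < m, p j = (e, s + j)) ∨ ∀ j < m, p j = (e, s + (m - 1 - j)) := by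
  induction m, hm using Nat.le_induction with
  | base =>
    refine ⟨(p 0).1, (p 0).2, Or.inl fun j hj => ?_⟩
    obtain rfl : j = 0 := by omega
    rfl
  | succ m hm ih =>
    obtain ⟨e, s, h⟩ := ih (fun j hj => hadj j (by omega))
      fun i hi j hj => hinj i (by omega) j (by omega)
    have h1 := hadj (m - 1) (by omega)
    rw [Nat.sub_add_cancel hm] at h1
    have h2 : 2 ≤ m → p m ≠ p (m - 2) := fun h2 h => by
      have := hinj m (by omega) (m - 2) (by omega) h
      omega
    obtain ⟨x, y, hxy⟩ : ∃ x y, p m = (x, y) := ⟨_, _, rfl⟩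
    rcases h with h | h
    · rw [h _ (by omega), hxy] at h1
      simp only [PosAdj] at h1
      obtain ⟨rfl, h1⟩ := h1
      rcases h1 with h1 | h1
      · refine ⟨e, s, Or.inl fun j hj => ?_⟩
        rcases Nat.lt_succ_iff_lt_or_eq.1 hj with hj | rfl
        · exact h j hj
        · rw [hxy]; ext <;> simp; omega
      · rcases Nat.lt_or_ge m 2 with h3 | h3
        · obtain rfl : m = 1 := by omega
          refine ⟨e, y, Or.inr fun j hj => ?_⟩
          interval_cases j
          · rw [h 0 (by omega)]; ext <;> simp; omega
          · rw [hxy]; ext <;> simp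
        · refine absurd ?_ (h2 h3)
          rw [h (m - 2) (by omega), hxy]
          ext <;> simp; omega
    · rw [h _ (by omega), hxy] at h1
      simp only [PosAdj] at h1
      obtain ⟨rfl, h1⟩ := h1
      rcases h1 with h1 | h1
      · rcases Nat.lt_or_ge m 2 with h3 | h3
        · obtain rfl : m = 1 := by omega
          refine ⟨e, s, Or.inl fun j hj => ?_⟩
          interval_cases j
          · rw [h 0 (by omega)]
          · rw [hxy]; ext <;> simp; omega
        · refine absurd ?_ (h2 h3)
          rw [h (m - 2) (by omega), hxy]
          ext <;> simp; omega
      · refine ⟨e, y, Or.inr fun j hj => ?_⟩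
        rcases Nat.lt_succ_iff_lt_or_eq.1 hj with hj | rfl
        · rw [h j hj]; ext <;> simp; omega
        · rw [hxy]; ext <;> simp

/-- The map `f` of positions is an isomorphism between two families of paths. -/
structure IsPathIso (F G : ℕ → List ℤ) (f : ℕ × ℕ → ℕ × ℕ) : Prop where
  occ : ∀ p, Occ F p → Occ G (f p)
  inj : ∀ p q, Occ F p → Occ F q → f p = f q → p = q
  adj : ∀ p q, Occ F p → Occ F q → (PosAdj p q ↔ PosAdj (f p) (f q))
  surj : ∀ q, Occ G q → ∃ p, Occ F p ∧ f p = q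
  weight_eq : ∀ p, Occ F p → weight F p = weight G (f p)

/-- An isomorphism of disjoint unions of paths maps components onto components, up to
reversal. -/
theorem IsPathIso.exists_component {F G : ℕ → List ℤ} {f : ℕ × ℕ → ℕ × ℕ} (hf : IsPathIso F G f)
    {i : ℕ} (hi : F i ≠ []) :
    ∃ e, (∀ j < (F i).length, (f (i, j)).1 = e) ∧
      (∀ k < (G e).length, ∃ j < (F i).length, f (i, j) = (e, k)) ∧
      (F i = G e ∨ F i = (G e).reverse) := by
  obtain ⟨hocc, hinj, hadj, hsurj, hw⟩ := hf
  have hpos := List.length_pos_of_ne_nil hi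
  obtain ⟨e, s, h⟩ := walk_monotone (p := fun j => f (i, j)) hpos
    (fun j hj => (hadj (i, j) (i, j + 1) (by simp only [Occ]; omega) hj).1 ⟨rfl, Or.inl rfl⟩)
    (fun a ha b hb hab => (Prod.ext_iff.1 (hinj _ _ ha hb hab)).2)
  have hfst : ∀ j < (F i).length, (f (i, j)).1 = e := fun j hj => by
    rcases h with h | h <;> simp [h j hj]
  have hcover : ∀ k, s ≤ k → k < s + (F i).length →
      ∃ j, j < (F i).length ∧ f (i, j) = (e, k) := by
    intro k h1 h2
    rcases h with h | h
    · refine ⟨k - s, by omega, ?_⟩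
      rw [h _ (by omega)]; ext <;> simp; omega
    · refine ⟨(F i).length - 1 - (k - s), by omega, ?_⟩
      rw [h _ (by omega)]; ext <;> simp; omega
  have hrange : ∀ j < (F i).length, s ≤ (f (i, j)).2 ∧ (f (i, j)).2 < s + (F i).length := by
    intro j hj
    rcases h with h | h <;> simp only [h j hj] <;> omega
  have hclosed : ∀ k k', s ≤ k → k < s + (F i).length → (k + 1 = k' ∨ k' + 1 = k) →
      k' < (G e).length → s ≤ k' ∧ k' < s + (F i).length := by
    intro k k' h1 h2 hkk hk'
    obtain ⟨j, hj, hfj⟩ := hcover k h1 h2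
    obtain ⟨⟨i', j'⟩, hq, hfq⟩ := hsurj (e, k') hk'
    have := (hadj (i, j) (i', j') hj hq).2 (by rw [hfj, hfq]; exact ⟨rfl, hkk⟩)
    obtain rfl : i = i' := this.1
    have := hrange j' hq
    rwa [hfq] at this
  have hend : s + (F i).length ≤ (G e).length := by
    obtain ⟨j, hj, hfj⟩ := hcover (s + (F i).length - 1) (by omega) (by omega)
    have := hocc (i, j) hj
    rw [hfj] at this
    simp only [Occ] at this
    omega
  have hs : s = 0 := by
    by_contra hs
    have := hclosed s (s - 1) (by omega) (by omega) (by omega) (by omega)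
    omega
  have hlen : (F i).length = (G e).length := by
    by_contra hne
    have := hclosed (s + (F i).length - 1) (s + (F i).length) (by omega) (by omega) (by omega)
      (by omega)
    omega
  subst hs
  refine ⟨e, hfst, fun k hk => hcover k (Nat.zero_le _) (by omega), ?_⟩
  rcases h with h | h
  · refine Or.inl (List.ext_getElem hlen fun j hj hj' => ?_)
    have := hw (i, j) hj
    rw [h j hj] at this
    simpa [weight, hj, hj'] using this
  · refine Or.inr (List.ext_getElem (by simpa using hlen) fun j hj hj' => ?_)
    have := hw (i, j) hj
    rw [h j hj] at this
    rw [List.getElem_reverse]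
    simp only [weight, zero_add] at this
    rw [List.getD_eq_getElem _ _ hj, List.getD_eq_getElem _ _ (by omega)] at this
    simpa [hlen] using this

theorem IsRep.reindex {N : ℕ} {F G : ℕ → List ℤ} {Φ : ℕ × ℕ → Fin N → ℤ} (hΦ : IsRep F Φ)
    {h : ℕ × ℕ → ℕ × ℕ} (hh : IsPathIso G F h) : IsRep G (Φ ∘ h) := by
  intro p q hp hq
  have : p = q ↔ h p = h q := ⟨congrArg h, hh.inj p q hp hq⟩
  rw [Function.comp, Function.comp, hΦ _ _ (hh.occ p hp) (hh.occ q hq), hh.weight_eq p hp]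
  simp only [this, hh.adj p q hp hq]

/-- `G` is obtained from the family of paths `F` by removing `t` consecutive vertices, starting
at index `a`, of the path `γ`; the vertices after them form the new path `n`. -/
structure IsCut (F G : ℕ → List ℤ) (γ n a t : ℕ) : Prop where
  ne : γ ≠ n
  empty : F n = []
  left : (G γ).length = a
  len : (F γ).length = a + t + (G n).length
  other : ∀ c, c ≠ γ → c ≠ n → G c = F c

/-- The inclusion of positions after a cut into positions before the cut. -/
def splice (γ n d : ℕ) (p : ℕ × ℕ) : ℕ × ℕ := if p.1 = n then (γ, d + p.2) else p

theorem ite_mul_ite_one (A B : Prop) [Decidable A] [Decidable B] :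
    (if A then (1 : ℤ) else 0) * (if B then 1 else 0) = if A ∧ B then 1 else 0 := by
  by_cases A <;> by_cases B <;> simp_all

namespace IsCut

variable {F G : ℕ → List ℤ} {γ n a t : ℕ}

theorem occ_cases (h : IsCut F G γ n a t) {p : ℕ × ℕ} (hp : Occ G p) :
    (p.1 = n ∧ (splice γ n (a + t) p).1 = γ ∧ (splice γ n (a + t) p).2 = a + t + p.2 ∧
        p.2 < (G n).length) ∨
      (p.1 = γ ∧ (splice γ n (a + t) p).1 = γ ∧ (splice γ n (a + t) p).2 = p.2 ∧ p.2 < a) ∨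
      (p.1 ≠ γ ∧ p.1 ≠ n ∧ splice γ n (a + t) p = p ∧ (splice γ n (a + t) p).1 = p.1 ∧
        (splice γ n (a + t) p).2 = p.2 ∧ p.2 < (F p.1).length) := by
  have hne := h.ne
  by_cases h1 : p.1 = n
  · refine Or.inl ⟨h1, by simp [splice, h1], by simp [splice, h1], ?_⟩
    rwa [Occ, h1] at hp
  · by_cases h2 : p.1 = γ
    · refine Or.inr (Or.inl ⟨h2, by rw [splice, if_neg h1, h2], by rw [splice, if_neg h1], ?_⟩)
      rwa [Occ, h2, h.left] at hp
    · refine Or.inr (Or.inr ⟨h2, h1, by simp [splice, h1], by simp [splice, h1],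
        by simp [splice, h1], ?_⟩)
      rwa [Occ, h.other _ h2 h1] at hp

theorem occ_splice (h : IsCut F G γ n a t) {p : ℕ × ℕ} (hp : Occ G p) :
    Occ F (splice γ n (a + t) p) ∧ ((splice γ n (a + t) p).1 = γ →
      (splice γ n (a + t) p).2 < a ∨ a + t ≤ (splice γ n (a + t) p).2) := by
  rcases h.occ_cases hp with ⟨h1, h2, h3, h4⟩ | ⟨h1, h2, h3, h4⟩ | ⟨h1, -, h5, h2, h3, h4⟩
  · rw [Occ, h2, h.len]
    omega
  · rw [Occ, h2, h.len]
    omega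
  · rw [Occ, h2]
    omega

theorem splice_inj (h : IsCut F G γ n a t) {p q : ℕ × ℕ} (hp : Occ G p) (hq : Occ G q)
    (hpq : splice γ n (a + t) p = splice γ n (a + t) q) : p = q := by
  have hne := h.ne
  obtain ⟨h1, h2⟩ := Prod.ext_iff.1 hpq
  have hp' := h.occ_cases hp
  have hq' := h.occ_cases hq
  exact Prod.ext (by omega) (by omega)

theorem adj_splice (h : IsCut F G γ n a t) (ht : 1 ≤ t) {p q : ℕ × ℕ} (hp : Occ G p)
    (hq : Occ G q) :
    PosAdj p q ↔ PosAdj (splice γ n (a + t) p) (splice γ n (a + t) q) := by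
  have hne := h.ne
  have hp' := h.occ_cases hp
  have hq' := h.occ_cases hq
  simp only [PosAdj]
  omega

theorem exists_splice (h : IsCut F G γ n a t) {q : ℕ × ℕ} (hq : Occ F q)
    (hq' : q.1 = γ → q.2 < a ∨ a + t ≤ q.2) :
    ∃ p, Occ G p ∧ splice γ n (a + t) p = q := by
  have hqn : q.1 ≠ n := fun hn => by
    rw [Occ, hn, h.empty] at hq
    simp at hq
  by_cases hγ : q.1 = γ
  · rcases hq' hγ with h1 | h1
    · exact ⟨q, by rw [Occ, hγ, h.left]; exact h1, if_neg hqn⟩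
    · rw [Occ, hγ, h.len] at hq
      refine ⟨(n, q.2 - (a + t)), by simp only [Occ]; omega, ?_⟩
      rw [splice, if_pos rfl]
      ext
      · exact hγ.symm
      · simp; omega
  · exact ⟨q, by rwa [Occ, h.other _ hγ hqn], if_neg hqn⟩

/-- Removing a long chain of vertices of weight two, and decreasing the weights of its
neighbours, saves one dimension more than the length of the chain. -/
theorem exists_isRep (h : IsCut F G γ n a t) {N : ℕ} {Φ : ℕ × ℕ → Fin N → ℤ} (hΦ : IsRep F Φ)
    (ht : 4 ≤ t) (htwo : ∀ i < t, weight F (γ, a + i) = 2)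
    (hlt : ∀ p, Occ F p → weight F p < t)
    (hw : ∀ p, Occ G p → weight G p = weight F (splice γ n (a + t) p) -
      (if p.1 = γ ∧ p.2 + 1 = a then 1 else 0) - if p.1 = n ∧ p.2 = 0 then 1 else 0) :
    t + 1 ≤ N ∧ ∃ Ψ : ℕ × ℕ → Fin (N - (t + 1)) → ℤ, IsRep G Ψ := by
  have hoccT : ∀ i < t, Occ F (γ, a + i) := fun i hi => by
    rw [Occ, h.len]
    simp only
    omega
  have hchain : IsTwoChain t fun i => Φ (γ, a + i) := by
    intro i hi j hj
    simp only
    rw [hΦ _ _ (hoccT i hi) (hoccT j hj), htwo i hi]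
    simp only [PosAdj, Prod.mk.injEq, true_and, Nat.add_left_cancel_iff, add_assoc]
  obtain ⟨e, he, hev⟩ := hchain.exists_orthonormal ht
  have he' : ∀ i < t + 1, ∀ j < t + 1, dot (e i) (e j) = if i = j then 1 else 0 :=
    fun i hi j hj => he i (by omega) j (by omega)
  obtain ⟨hN, π, hπ⟩ := exists_projection he'
  refine ⟨hN, fun p => π (Φ (splice γ n (a + t) p)), ?_⟩
  have hne := h.ne
  have hcoeff : ∀ p, Occ G p → ∀ i ≤ t, dot (Φ (splice γ n (a + t) p)) (e i) =
      (if i = t ∧ (p.1 = n ∧ p.2 = 0) then 1 else 0) -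
        if i = 0 ∧ (p.1 = γ ∧ p.2 + 1 = a) then 1 else 0 := by
    intro p hp
    obtain ⟨hocc, havoid⟩ := h.occ_splice hp
    refine coeff_eq (by omega) he' hev (by omega) (fun i hi => ?_) ?_
    · have hp' := h.occ_cases hp
      rw [hΦ _ _ hocc (hoccT i hi), if_neg fun h' => by rw [h'] at hp'; simp only at hp'; omega]
      simp only [PosAdj]
      split_ifs <;> omega
    · rw [hΦ _ _ hocc hocc, if_pos rfl]
      exact hlt _ hocc
  intro p q hp hq
  have hsum : ∑ i ∈ Finset.range (t + 1), dot (Φ (splice γ n (a + t) p)) (e i) *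
      dot (Φ (splice γ n (a + t) q)) (e i) =
      (if (p.1 = n ∧ p.2 = 0) ∧ q.1 = n ∧ q.2 = 0 then 1 else 0) +
        if (p.1 = γ ∧ p.2 + 1 = a) ∧ q.1 = γ ∧ q.2 + 1 = a then 1 else 0 := by
    have h0 : ∀ p, Occ G p → dot (Φ (splice γ n (a + t) p)) (e 0) =
        -if p.1 = γ ∧ p.2 + 1 = a then 1 else 0 := fun p hp => by
      rw [hcoeff p hp 0 (by omega), if_neg (by omega)]
      simp
    have hlast : ∀ p, Occ G p → dot (Φ (splice γ n (a + t) p)) (e t) =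
        if p.1 = n ∧ p.2 = 0 then 1 else 0 := fun p hp => by
      rw [hcoeff p hp t le_rfl, if_neg (by omega : ¬ (t = 0 ∧ _))]
      simp
    have hmid : ∀ i ∈ Finset.range (t - 1), dot (Φ (splice γ n (a + t) p)) (e (i + 1)) *
        dot (Φ (splice γ n (a + t) q)) (e (i + 1)) = 0 := fun i hi => by
      have hi : i < t - 1 := by simpa using hi
      rw [hcoeff p hp _ (by omega), if_neg (by omega), if_neg (by omega)]
      simp
    have hsplit := Finset.sum_range_succ' (fun i => dot (Φ (splice γ n (a + t) p)) (e i) *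
      dot (Φ (splice γ n (a + t) q)) (e i)) (t - 1)
    rw [Nat.sub_add_cancel (by omega), Finset.sum_eq_zero hmid] at hsplit
    rw [Finset.sum_range_succ, hsplit, h0 p hp, h0 q hq, hlast p hp, hlast q hq, neg_mul_neg,
      ite_mul_ite_one, ite_mul_ite_one]
    ring
  rw [hπ, hsum, hΦ _ _ (h.occ_splice hp).1 (h.occ_splice hq).1]
  by_cases hpq : p = q
  · subst hpq
    rw [if_pos rfl, if_pos rfl, hw p hp]
    simp only [and_self]
    ring
  · have h1 : ¬((p.1 = n ∧ p.2 = 0) ∧ q.1 = n ∧ q.2 = 0) := fun h' =>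
      hpq (Prod.ext (by omega) (by omega))
    have h2 : ¬((p.1 = γ ∧ p.2 + 1 = a) ∧ q.1 = γ ∧ q.2 + 1 = a) := fun h' =>
      hpq (Prod.ext (by omega) (by omega))
    rw [if_neg h1, if_neg h2, if_neg hpq, if_neg fun h' => hpq (h.splice_inj hp hq h'), add_zero,
      sub_zero]
    exact if_congr (h.adj_splice (by omega) hp hq).symm rfl rfl

end IsCut

/-- The families of paths `F` and `E` consist of negatives of weights of a plumbing and of weights
of its dual. -/
def IsDualFamily (F E : ℕ → List ℤ) : Prop :=
  ∀ i, (F i = [] ∧ E i = []) ∨ (F i ≠ [] ∧ Riem ((F i).map fun x => -x) (E i))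

theorem IsDualFamily.exists_isPathIso {F E F' E' : ℕ → List ℤ} (hE : IsDualFamily F E)
    (hE' : IsDualFamily F' E') {f : ℕ × ℕ → ℕ × ℕ} (hf : IsPathIso F F' f) :
    ∃ h, IsPathIso E E' h := by
  have hcomp : ∀ i, ∃ e, F i ≠ [] → (∀ j < (F i).length, (f (i, j)).1 = e) ∧
      (∀ k < (F' e).length, ∃ j < (F i).length, f (i, j) = (e, k)) ∧
      (F i = F' e ∨ F i = (F' e).reverse) := by
    intro i
    by_cases hi : F i = []
    · exact ⟨0, fun h => absurd hi h⟩
    · obtain ⟨e, he⟩ := hf.exists_component hi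
      exact ⟨e, fun _ => he⟩
  choose κ hκ using hcomp
  have hne : ∀ {p}, Occ E p → F p.1 ≠ [] := by
    intro p hp h
    rcases hE p.1 with ⟨-, h'⟩ | ⟨h', -⟩
    · simp [Occ, h'] at hp
    · exact h' h
  have hF' : ∀ {i}, F i ≠ [] → F' (κ i) ≠ [] := by
    intro i hi h
    rcases (hκ i hi).2.2 with h' | h' <;> exact hi (by simpa [h] using h')
  have hκinj : ∀ {i i'}, F i ≠ [] → F i' ≠ [] → κ i = κ i' → i = i' := by
    intro i i' hi hi' h
    have hpos := List.length_pos_of_ne_nil (hF' hi)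
    obtain ⟨j, hj, h1⟩ := (hκ i hi).2.1 0 hpos
    obtain ⟨j', hj', h2⟩ := (hκ i' hi').2.1 0 (h ▸ hpos)
    exact (Prod.ext_iff.1 (hf.inj (i, j) (i', j') hj hj' (by rw [h1, h2, h]))).1
  have hκsurj : ∀ {e}, F' e ≠ [] → ∃ i, F i ≠ [] ∧ κ i = e := by
    intro e he
    obtain ⟨⟨i, j⟩, hp, hq⟩ := hf.surj (e, 0) (List.length_pos_of_ne_nil he)
    have hi : F i ≠ [] := List.ne_nil_of_length_pos (by simp only [Occ] at hp; omega)
    exact ⟨i, hi, by rw [← (hκ i hi).1 j hp, hq]⟩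
  have hrow : ∀ {i}, F i ≠ [] → E i = E' (κ i) ∨ E i = (E' (κ i)).reverse := by
    intro i hi
    have h1 := ((hE i).resolve_left fun h => hi h.1).2
    have h2 := ((hE' (κ i)).resolve_left fun h => hF' hi h.1).2
    rcases (hκ i hi).2.2 with h | h <;> rw [h] at h1
    · exact Or.inl (h1.unique h2)
    · rw [List.map_reverse] at h1
      exact Or.inr (h1.unique h2.reverse)
  have hlen : ∀ {i}, F i ≠ [] → (E i).length = (E' (κ i)).length := by
    intro i hi
    rcases hrow hi with h | h <;> simp [h]
  let σ : ℕ → ℕ → ℕ := fun i j => if E i = E' (κ i) then j else (E i).length - 1 - j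
  have hσ : ∀ i, (∀ j, σ i j = j) ∨ ∀ j, σ i j = (E i).length - 1 - j := by
    intro i
    by_cases h : E i = E' (κ i)
    · exact Or.inl fun j => if_pos h
    · exact Or.inr fun j => if_neg h
  refine ⟨fun p => (κ p.1, σ p.1 p.2), ?_, ?_, ?_, ?_, ?_⟩
  · intro p hp
    have h1 := hlen (hne hp)
    simp only [Occ] at hp ⊢
    rcases hσ p.1 with h | h <;> rw [h] <;> omega
  · rintro ⟨i, j⟩ ⟨i', j'⟩ hp hq hpq
    obtain ⟨h1, h2⟩ := Prod.ext_iff.1 hpq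
    obtain rfl : i = i' := hκinj (hne hp) (hne hq) h1
    simp only [Occ] at hp hq h2
    rcases hσ i with h | h <;> rw [h, h] at h2 <;> simp only [Prod.mk.injEq, true_and] <;> omega
  · rintro ⟨i, j⟩ ⟨i', j'⟩ hp hq
    simp only [PosAdj]
    by_cases hi : i = i'
    · subst hi
      simp only [Occ] at hp hq
      rcases hσ i with h | h <;> rw [h, h] <;> simp only [true_and]
      omega
    · have : κ i ≠ κ i' := fun h => hi (hκinj (hne hp) (hne hq) h)
      simp [hi, this]
  · rintro ⟨e, k⟩ hq
    have he : F' e ≠ [] := fun h => by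
      rcases hE' e with ⟨-, h'⟩ | ⟨h', -⟩
      · simp [Occ, h'] at hq
      · exact h' h
    obtain ⟨i, hi, rfl⟩ := hκsurj he
    have h1 := hlen hi
    simp only [Occ] at hq
    rcases hσ i with h | h
    · exact ⟨(i, k), by simp only [Occ]; omega, by simp only [h]⟩
    · refine ⟨(i, (E i).length - 1 - k), by simp only [Occ]; omega, ?_⟩
      simp only [h, Prod.mk.injEq, true_and]
      omega
  · rintro ⟨i, j⟩ hp
    have h1 := hlen (hne hp)
    have h2 := hrow (hne hp)
    simp only [weight, σ]
    simp only [Occ] at hp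
    split_ifs with h
    · rw [h]
    · rw [h2.resolve_left h] at hp ⊢
      simp only [List.length_reverse] at hp ⊢
      rw [List.getD_eq_getElem _ _ (by simpa using hp), List.getD_eq_getElem _ _ (by omega),
        List.getElem_reverse]

namespace IsDualPair

variable {P D : List (List ℤ)}

theorem riem (h : IsDualPair P D) {i : ℕ} (hi : i < P.length) :
    row P i ≠ [] ∧ (∀ x ∈ row P i, x ≤ -2) ∧ Riem ((row P i).map fun x => -x) (row D i) := by
  obtain ⟨hl, h⟩ := h
  have hd := h ⟨i, hi⟩
  rw [row_of_lt hi, row_of_lt (hl ▸ hi)]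
  refine ⟨fun h0 => hd.1 (by simp [h0]), fun x hx => ?_, hd.riem⟩
  have := hd.2.2.1 (-x) (List.mem_map_of_mem hx)
  omega

theorem isDualFamily (h : IsDualPair P D) : IsDualFamily (row P) (row D) := by
  intro i
  rcases Nat.lt_or_ge i P.length with hi | hi
  · exact Or.inr ⟨(h.riem hi).1, (h.riem hi).2.2⟩
  · exact Or.inl ⟨List.getD_eq_default _ _ hi, List.getD_eq_default _ _ (h.1 ▸ hi)⟩

end IsDualPair

/-- A run of vertices of weight `-2` contains many pairwise non-adjacent ones. -/
theorem isInducedSubgraph_replicate {P : List (List ℤ)} {i m k : ℕ} {u v : List ℤ}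
    (h : row P i = u ++ List.replicate m (-2) ++ v) (hm : 2 * k ≤ m + 1) :
    IsInducedSubgraph (ofList (List.replicate k [(-2 : ℤ)])) (ofList P) := by
  have hlt : ∀ x : (ofList (List.replicate k [(-2 : ℤ)])).V, (pos x).1 < k ∧ (pos x).2 = 0 := by
    intro x
    have h1 := lt_of_occ (occ_pos x)
    have h2 := occ_pos x
    rw [Occ, row_of_lt h1] at h2
    simp only [List.getElem_replicate, List.length_singleton] at h2
    exact ⟨by simpa using h1, by omega⟩
  have hget : ∀ q < k, (row P i).getD (u.length + 2 * q) 0 = -2 := by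
    intro q hq
    rw [h, List.append_assoc, List.getD_append_right _ _ _ _ (by omega),
      List.getD_append _ _ _ _ (by simp; omega), List.getD_replicate _ (by omega)]
  have hex : ∀ x : (ofList (List.replicate k [(-2 : ℤ)])).V,
      ∃ y : (ofList P).V, pos y = (i, u.length + 2 * (pos x).1) := fun x => by
    refine exists_pos ?_
    have := (hlt x).1
    rw [Occ, h]
    simp
    omega
  choose f hf using hex
  refine ⟨f, fun x y hxy => ?_, fun x => ?_, fun x y => ?_⟩
  · have h1 : pos (f x) = pos (f y) := congrArg pos hxy
    have h2 := hlt x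
    have h3 := hlt y
    rw [hf, hf, Prod.mk.injEq] at h1
    exact pos_injective (Prod.ext (by omega) (by omega))
  · rw [w_eq_weight, w_eq_weight, hf, weight, weight, hget _ (hlt x).1, (hlt x).2, row_of_lt
      (lt_of_occ (occ_pos x))]
    simp
  · have h2 := hlt x
    have h3 := hlt y
    rw [adj_iff_posAdj, adj_iff_posAdj, hf, hf]
    simp only [PosAdj, true_and]
    omega

/-- Weights of the dual are bounded when there are few pairwise non-adjacent vertices of weight
`-2`. -/
theorem IsDualPair.le_of_not_isInducedSubgraph {P D : List (List ℤ)} (h : IsDualPair P D) {k : ℕ}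
    (hC : ¬ IsInducedSubgraph (ofList (List.replicate k [(-2 : ℤ)])) (ofList P)) {p : ℕ × ℕ}
    (hp : Occ (row D) p) : weight (row D) p ≤ 2 * k + 1 := by
  by_contra! hlt
  have hi : p.1 < P.length := h.1 ▸ lt_of_occ hp
  have hx : weight (row D) p ∈ row D p.1 := by
    rw [weight, List.getD_eq_getElem _ _ hp]
    exact List.getElem_mem _
  obtain ⟨u, v, huv⟩ := (h.riem hi).2.2.exists_run_of_two hx
  have hrow := congrArg (List.map fun x => -x) huv
  simp only [List.map_map, Function.comp_def, neg_neg, List.map_id', List.map_append,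
    List.map_replicate] at hrow
  exact hC (isInducedSubgraph_replicate hrow (by omega))

/-- How the dual changes when an entry of a sequence is removed: a run of entries `2` disappears,
and the neighbours of the run decrease by one. -/
theorem Riem.exists_delete {l r b : List ℤ} {A : ℤ} (h : Riem (l ++ A :: r) b)
    (hl : ∀ x ∈ l, 2 ≤ x) (hr : ∀ x ∈ r, 2 ≤ x) (hA : 3 ≤ A) :
    ∃ (U V El Er : List ℤ) (t : ℕ), b = U ++ List.replicate t 2 ++ V ∧ A ≤ t + 3 ∧
      ((l = [] ∧ El = []) ∨ (l ≠ [] ∧ Riem l El)) ∧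
      ((r = [] ∧ Er = []) ∨ (r ≠ [] ∧ Riem r Er)) ∧
      El.length = U.length ∧ Er.length = V.length ∧
      (∀ i < U.length, El.getD i 0 = U.getD i 0 - if i + 1 = U.length then 1 else 0) ∧
      ∀ i < V.length, Er.getD i 0 = V.getD i 0 - if i = 0 then 1 else 0 := by
  obtain ⟨βl, hβl⟩ := exists_dual hl
  obtain ⟨βr, hβr⟩ := exists_dual hr
  obtain ⟨bl, x, rfl⟩ := List.eq_nil_or_concat' βl |>.resolve_left hβl.ne_nil
  obtain ⟨y, br, rfl⟩ := List.exists_cons_of_ne_nil hβr.ne_nil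
  have hb := h.unique (hβl.join rfl hβr hA)
  obtain ⟨U, El, s, hU, hEl, hlen, hw⟩ : ∃ (U El : List ℤ) (s : ℕ),
      bl ++ [x + 1] = U ++ List.replicate s 2 ∧
      ((l = [] ∧ El = []) ∨ (l ≠ [] ∧ Riem l El)) ∧ El.length = U.length ∧
      ∀ i < U.length, El.getD i 0 = U.getD i 0 - if i + 1 = U.length then 1 else 0 := by
    by_cases h0 : l = []
    · subst h0
      obtain ⟨rfl, h1⟩ := List.append_inj' (t₁ := [x]) (s₂ := []) hβl.nil_left rfl
      obtain rfl : x = 1 := by simpa using h1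
      exact ⟨[], [], 1, rfl, Or.inl ⟨rfl, rfl⟩, rfl, by simp⟩
    · refine ⟨bl ++ [x + 1], bl ++ [x], 0, by simp, Or.inr ⟨h0, hβl⟩, by simp, fun i hi => ?_⟩
      simp only [List.length_append, List.length_singleton] at hi ⊢
      rcases Nat.lt_succ_iff_lt_or_eq.1 hi with hi | rfl
      · rw [if_neg (by omega), List.getD_append _ _ _ _ hi, List.getD_append _ _ _ _ hi, sub_zero]
      · simp
  obtain ⟨V, Er, s', hV, hEr, hlen', hw'⟩ : ∃ (V Er : List ℤ) (s : ℕ),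
      (y + 1) :: br = List.replicate s 2 ++ V ∧
      ((r = [] ∧ Er = []) ∨ (r ≠ [] ∧ Riem r Er)) ∧ Er.length = V.length ∧
      ∀ i < V.length, Er.getD i 0 = V.getD i 0 - if i = 0 then 1 else 0 := by
    by_cases h0 : r = []
    · subst h0
      obtain ⟨rfl, rfl⟩ := List.cons.inj hβr.nil_left
      exact ⟨[], [], 1, rfl, Or.inl ⟨rfl, rfl⟩, rfl, by simp⟩
    · refine ⟨(y + 1) :: br, y :: br, 0, by simp, Or.inr ⟨h0, hβr⟩, by simp, fun i hi => ?_⟩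
      cases i <;> simp
  refine ⟨U, V, El, Er, s + (A - 3).toNat + s', ?_, by omega, hEl, hEr, hlen, hlen', hw, hw'⟩
  rw [hb, ← List.singleton_append (l := List.replicate _ _ ++ _), ← List.append_assoc, hU, hV]
  simp only [List.replicate_add, List.append_assoc]

/-- The family of paths obtained by replacing the path `γ` by `x` and the path `n` by `y`. -/
def cutAt (F : ℕ → List ℤ) (γ n : ℕ) (x y : List ℤ) : ℕ → List ℤ :=
  Function.update (Function.update F γ x) n y

section Cut

variable {F : ℕ → List ℤ} {γ n : ℕ} {u m v x y : List ℤ}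

theorem cutAt_new : cutAt F γ n x y n = y := Function.update_self ..

theorem cutAt_old (h : γ ≠ n) : cutAt F γ n x y γ = x := by
  rw [cutAt, Function.update_of_ne h, Function.update_self]

theorem cutAt_other {c : ℕ} (h : c ≠ γ) (h' : c ≠ n) : cutAt F γ n x y c = F c := by
  rw [cutAt, Function.update_of_ne h', Function.update_of_ne h]

theorem isCut_cutAt (hne : γ ≠ n) (hn : F n = []) (hF : F γ = u ++ m ++ v)
    (hx : x.length = u.length) (hy : y.length = v.length) :
    IsCut F (cutAt F γ n x y) γ n u.length m.length where
  ne := hne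
  empty := hn
  left := by rw [cutAt_old hne, hx]
  len := by rw [cutAt_new, hF, hy]; simp [add_assoc]
  other c := cutAt_other

theorem weight_cutAt (hne : γ ≠ n) (hF : F γ = u ++ m ++ v)
    (hx : x.length = u.length) (hy : y.length = v.length) {α β : ℕ → ℤ}
    (hα : ∀ i < u.length, x.getD i 0 = u.getD i 0 - α i)
    (hβ : ∀ i < v.length, y.getD i 0 = v.getD i 0 - β i) {p : ℕ × ℕ}
    (hp : Occ (cutAt F γ n x y) p) :
    weight (cutAt F γ n x y) p = weight F (splice γ n (u.length + m.length) p) -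
      (if p.1 = γ then α p.2 else 0) - if p.1 = n then β p.2 else 0 := by
  obtain ⟨c, j⟩ := p
  simp only [Occ, weight, splice] at hp ⊢
  by_cases hc : c = n
  · subst hc
    rw [cutAt_new] at hp ⊢
    rw [if_pos rfl, if_pos rfl, if_neg hne.symm, hF, hβ _ (by omega), ← List.length_append,
      List.getD_append_right _ _ _ _ (by omega), Nat.add_sub_cancel_left, sub_zero]
  · rw [if_neg hc, if_neg hc]
    by_cases hc' : c = γ
    · subst hc'
      rw [cutAt_old hne] at hp ⊢
      rw [if_pos rfl, hF, hα _ (by omega), List.append_assoc,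
        List.getD_append _ _ _ _ (by omega), sub_zero]
    · rw [if_neg hc', cutAt_other hc' hc, sub_zero, sub_zero]

theorem IsDualFamily.cutAt {E : ℕ → List ℤ} (h : IsDualFamily F E) (hne : γ ≠ n)
    {x' y' : List ℤ}
    (hx : (x = [] ∧ x' = []) ∨ (x ≠ [] ∧ Riem (x.map fun z => -z) x'))
    (hy : (y = [] ∧ y' = []) ∨ (y ≠ [] ∧ Riem (y.map fun z => -z) y')) :
    IsDualFamily (cutAt F γ n x y) (LensPaper.cutAt E γ n x' y') := by
  intro c
  by_cases hc : c = n
  · subst hc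
    rwa [cutAt_new, cutAt_new]
  · by_cases hc' : c = γ
    · subst hc'
      rwa [cutAt_old hne, cutAt_old hne]
    · rw [cutAt_other hc' hc, cutAt_other hc' hc]
      exact h c

end Cut

theorem IsCut.totalLen_le {L L' : List (List ℤ)} {G : ℕ → List ℤ} {γ n a t : ℕ}
    (h : IsCut (row L) G γ n a t) {f : ℕ × ℕ → ℕ × ℕ} (hf : IsPathIso (row L') G f) :
    totalLen L ≤ t + totalLen L' := by
  refine (LensPaper.totalLen_le (S := (Finset.range t).image fun i => (γ, a + i))
    (h := splice γ n (a + t) ∘ f) fun q hq => ?_).trans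
      (Nat.add_le_add_right (Finset.card_image_le.trans_eq (Finset.card_range t)) _)
  by_cases hq' : q.1 = γ → q.2 < a ∨ a + t ≤ q.2
  · obtain ⟨p, hp, rfl⟩ := h.exists_splice hq hq'
    obtain ⟨p', hp', rfl⟩ := hf.surj p hp
    exact Or.inr ⟨p', hp', rfl⟩
  · push Not at hq'
    exact Or.inl (Finset.mem_image.2 ⟨q.2 - a, Finset.mem_range.2 (by omega),
      Prod.ext hq'.1.symm (by simp only; omega)⟩)

/-- Deleting a vertex of a disjoint union of paths cuts the path containing it. -/
theorem IsCut.exists_isPathIso {P P' : List (List ℤ)} {G : ℕ → List ℤ} {γ n a : ℕ}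
    (h : IsCut (row P) G γ n a 1)
    (hw : ∀ p, Occ G p → weight G p = weight (row P) (splice γ n (a + 1) p))
    {g : (ofList P).V} (hg : pos g = (γ, a)) (hind : IsInducedOn (ofList P') (ofList P) {g}ᶜ) :
    ∃ f, IsPathIso (row P') G f := by
  obtain ⟨f, hinj, hfw, hadj, hrange⟩ := hind
  have hex : ∀ v, ∃ p, Occ G p ∧ splice γ n (a + 1) p = pos (f v) := by
    intro v
    have hv : f v ≠ g := by
      have : f v ∈ ({g}ᶜ : Set _) := hrange ▸ Set.mem_range_self v
      simpa using this
    refine h.exists_splice (occ_pos _) fun h1 => ?_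
    by_contra! h2
    exact hv (pos_injective (hg ▸ Prod.ext h1 (by simp only; omega)))
  choose φ hφ hsp using hex
  have hF : ∀ v, Function.extend pos φ id (pos v) = φ v := pos_injective.extend_apply _ _
  refine ⟨Function.extend pos φ id, fun p hp => ?_, fun p q hp hq hpq => ?_, fun p q hp hq => ?_,
    fun q hq => ?_, fun p hp => ?_⟩
  · obtain ⟨v, rfl⟩ := exists_pos hp
    rw [hF]
    exact hφ v
  · obtain ⟨u, rfl⟩ := exists_pos hp
    obtain ⟨v, rfl⟩ := exists_pos hq
    rw [hF, hF] at hpq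
    exact congrArg pos (hinj (pos_injective (by rw [← hsp, hpq, hsp])))
  · obtain ⟨u, rfl⟩ := exists_pos hp
    obtain ⟨v, rfl⟩ := exists_pos hq
    rw [hF, hF, ← adj_iff_posAdj, hadj, adj_iff_posAdj, ← hsp, ← hsp,
      ← h.adj_splice le_rfl (hφ u) (hφ v)]
  · obtain ⟨hocc, havoid⟩ := h.occ_splice hq
    obtain ⟨u, hu⟩ := exists_pos hocc
    have hug : u ≠ g := by
      rintro rfl
      rw [← hu, hg] at havoid
      simp at havoid
    obtain ⟨v, rfl⟩ : u ∈ Set.range f := by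
      rw [hrange]
      simpa using hug
    exact ⟨pos v, occ_pos v, by rw [hF]; exact h.splice_inj (hφ v) hq (by rw [hsp, hu])⟩
  · obtain ⟨v, rfl⟩ := exists_pos hp
    rw [hF, hw _ (hφ v), hsp, ← w_eq_weight, ← w_eq_weight, hfw]

/-- Lemma 6.2: deleting a vertex of very large weight from a graph failing
Property `X_k` (and containing no `C_{k'}`) again yields a graph failing
Property `X_k`. -/
theorem statement15 (k k' : ℕ) (hk : 0 < k)
    (hk' : k' = if Even k then k else k + 1)
    (P D : List (List ℤ)) (hdual : IsDualPair P D)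
    (hfail : FailsX k P D)
    (hC : ¬ IsInducedSubgraph (ofList (List.replicate k' [(-2 : ℤ)])) (ofList P))
    (g : (ofList P).V) (hg : (2 * (k' : ℤ) + 6) ≤ |(ofList P).w g|)
    (P' D' : List (List ℤ)) (hdual' : IsDualPair P' D')
    (hind : IsInducedOn (ofList P') (ofList P) {g}ᶜ) :
    FailsX k P' D' := by
  have hk0 : 0 < k' := by
    split_ifs at hk' <;> omega
  obtain ⟨hkn, φ, hφ⟩ := hfail
  obtain ⟨Φ, hΦ⟩ := exists_isRep hφ
  obtain ⟨γ, ρ, hpos⟩ : ∃ γ ρ, pos g = (γ, ρ) := ⟨_, _, rfl⟩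
  have hocc := occ_pos g
  rw [hpos] at hocc
  have hγ := lt_of_occ hocc
  obtain ⟨hne, hle, hR⟩ := hdual.riem hγ
  have hPn : row P P.length = [] := List.getD_eq_default _ _ le_rfl
  have hDn : row D P.length = [] := List.getD_eq_default _ _ hdual.1.ge
  have hγn : γ ≠ P.length := Nat.ne_of_lt hγ
  obtain ⟨l, r, w, hrow, hlρ, hwg⟩ : ∃ l r w, row P γ = l ++ [w] ++ r ∧ l.length = ρ ∧
      (ofList P).w g = w := by
    refine ⟨(row P γ).take ρ, (row P γ).drop (ρ + 1), (row P γ)[ρ], ?_, ?_, ?_⟩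
    · rw [List.take_append_getElem, List.take_append_drop]
    · rw [List.length_take]
      exact min_eq_left hocc.le
    · rw [w_eq_weight, hpos, weight, List.getD_eq_getElem _ _ hocc]
  subst hlρ
  rw [hwg, abs_of_nonpos (by have := hle w (by simp [hrow]); omega)] at hg
  rw [hrow, List.append_assoc, List.map_append, List.singleton_append, List.map_cons] at hR
  obtain ⟨U, V, El, Er, t, hrowD, ht, hEl, hEr, hlenl, hlenr, hwl, hwr⟩ := hR.exists_delete
    (by
      intro x hx
      obtain ⟨z, hz, rfl⟩ := List.mem_map.1 hx
      have := hle z (by simp [hrow, hz])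
      omega)
    (by
      intro x hx
      obtain ⟨z, hz, rfl⟩ := List.mem_map.1 hx
      have := hle z (by simp [hrow, hz])
      omega)
    (by omega)
  simp only [ne_eq, List.map_eq_nil_iff] at hEl hEr
  have hcutP := isCut_cutAt hγn hPn hrow rfl rfl
  have hcutD := isCut_cutAt hγn hDn hrowD hlenl hlenr
  obtain ⟨f, hf⟩ := hcutP.exists_isPathIso
    (fun p hp => by
      simpa using weight_cutAt hγn hrow rfl rfl (α := 0) (β := 0) (by simp) (by simp) hp) hpos hind
  obtain ⟨h, hh⟩ := hdual'.isDualFamily.exists_isPathIso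
    (hdual.isDualFamily.cutAt hγn hEl hEr) hf
  rw [List.length_replicate] at hcutD
  obtain ⟨hN, Ψ, hΨ⟩ := hcutD.exists_isRep hΦ (by omega)
    (fun i hi => by
      rw [weight, hrowD, List.append_assoc, List.getD_append_right _ _ _ _ (by simp),
        List.getD_append _ _ _ _ (by simpa using hi)]
      simp [hi])
    (fun p hp => (hdual.le_of_not_isInducedSubgraph hC hp).trans_lt (by omega))
    (fun p hp => by
      rw [weight_cutAt hγn hrowD hlenl hlenr hwl hwr hp, List.length_replicate, ite_and, ite_and])
  have h1 := hcutP.totalLen_le hf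
  have h2 := hcutD.totalLen_le hh
  rw [List.length_singleton] at h1
  obtain ⟨Ψ', hΨ'⟩ := (hΨ.reindex hh).pad (M := totalLen P' + totalLen D' - k) (by omega)
  exact ⟨by omega, _, hΨ'.isEmbedding⟩

end LensPaper
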